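/- arXiv:2303.05402 — 2 statements merged into one kernel-verified Lean document; each statement's English description precedes it below -/
import Mathlib

section
/- The infinite series identity $\sum_{k=0}^{\infty}\Big(\frac{1}{4}\Big)^k\frac{((1)_k)^2}{(5/4)_k\,(7/4)_k}\Big\{\frac{5+6k}{1+2k}H_{k}^{(2)}-\frac{24+32k}{(1+2k)^3}\Big\} = -24\beta(4)$ holds. -/
open scoped BigOperators

/-- The shifted factorial (Pochhammer symbol) `(x)_n = x (x+1) ⋯ (x+n-1)`. -/
noncomputable def poch (x : ℝ) (n : ℕ) : ℝ := ∏ i ∈ Finset.range n, (x + i)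

/-- The harmonic numbers of order 2, `H_n^{(2)} = ∑_{j=1}^n 1/j²`. -/
noncomputable def H2 (n : ℕ) : ℝ := ∑ j ∈ Finset.range n, 1 / ((j : ℝ) + 1) ^ 2

/-- The Dirichlet beta value `β(4) = ∑_{k≥0} (-1)^k/(1+2k)⁴`. -/
noncomputable def beta4 : ℝ := ∑' k : ℕ, (-1) ^ k / (1 + 2 * (k : ℝ)) ^ 4

/-- The Catalan constant `G = ∑_{k≥0} (-1)^k/(1+2k)²`. -/
noncomputable def catalanG : ℝ := ∑' k : ℕ, (-1) ^ k / (1 + 2 * (k : ℝ)) ^ 2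

open Filter Topology

/-- The ratio `k!² / (a)_{2k+1}`. -/
noncomputable def sqFactorialRatio (a : ℝ) (k : ℕ) : ℝ :=
  a⁻¹ * ∏ i ∈ Finset.range k, ((i : ℝ) + 1) ^ 2 / ((a + 2 * i + 1) * (a + 2 * i + 2))

lemma sqFactorialRatio_zero (a : ℝ) : sqFactorialRatio a 0 = a⁻¹ := by
  simp [sqFactorialRatio]

lemma sqFactorialRatio_succ (a : ℝ) (k : ℕ) :
    sqFactorialRatio a (k + 1) =
      sqFactorialRatio a k * (((k : ℝ) + 1) ^ 2 / ((a + 2 * k + 1) * (a + 2 * k + 2))) := by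
  simp only [sqFactorialRatio, Finset.prod_range_succ, mul_assoc]

lemma sqFactorialRatio_shift {a : ℝ} (ha : 0 < a) (k : ℕ) :
    sqFactorialRatio (a + 1) k = sqFactorialRatio a k * (a / (a + 2 * k + 1)) := by
  induction k with
  | zero =>
    simp only [sqFactorialRatio_zero]
    push_cast
    field_simp
    ring
  | succ k ih =>
    rw [sqFactorialRatio_succ, sqFactorialRatio_succ, ih]
    have h1 : a + 2 * (k : ℝ) + 1 ≠ 0 := by positivity
    have h2 : a + 2 * (k : ℝ) + 2 ≠ 0 := by positivity
    have h3 : a + 2 * (k : ℝ) + 3 ≠ 0 := by positivity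
    have e1 : a + 1 + 2 * (k : ℝ) + 1 = a + 2 * k + 2 := by ring
    have e2 : a + 1 + 2 * (k : ℝ) + 2 = a + 2 * k + 3 := by ring
    have e3 : a + 2 * ((k + 1 : ℕ) : ℝ) + 1 = a + 2 * k + 3 := by push_cast; ring
    rw [e1, e2, e3]
    field_simp

lemma sqFactorialRatio_nonneg {a : ℝ} (ha : 0 < a) (k : ℕ) : 0 ≤ sqFactorialRatio a k := by
  unfold sqFactorialRatio
  positivity

lemma sqFactorialRatio_le {a : ℝ} (ha : 1 / 2 ≤ a) (k : ℕ) :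
    sqFactorialRatio a k ≤ a⁻¹ * (1 / 2) ^ k := by
  have ha0 : 0 < a := by linarith
  induction k with
  | zero => simp [sqFactorialRatio_zero]
  | succ k ih =>
    have hr : ((k : ℝ) + 1) ^ 2 / ((a + 2 * k + 1) * (a + 2 * k + 2)) ≤ 1 / 2 := by
      rw [div_le_div_iff₀ (by positivity) (by norm_num)]
      have hk : (0 : ℝ) ≤ k := k.cast_nonneg
      nlinarith [mul_nonneg hk ha0.le]
    rw [sqFactorialRatio_succ, pow_succ (1 / 2 : ℝ), ← mul_assoc]
    exact mul_le_mul ih hr (by positivity) (by positivity)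

lemma H2_succ (k : ℕ) : H2 (k + 1) = H2 k + 1 / ((k : ℝ) + 1) ^ 2 :=
  Finset.sum_range_succ _ _

lemma H2_nonneg (k : ℕ) : 0 ≤ H2 k := Finset.sum_nonneg fun _ _ => by positivity

lemma H2_le_two (k : ℕ) : H2 k ≤ 2 := by
  have h : H2 k ≤ 2 - 1 / ((k : ℝ) + 1 / 2) := by
    induction k with
    | zero => norm_num [H2]
    | succ k ih =>
      have h1 : 1 / ((k : ℝ) + 1) ^ 2 ≤ 1 / ((k : ℝ) + 1 / 2) - 1 / ((k : ℝ) + 1 + 1 / 2) := by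
        rw [div_sub_div _ _ (by positivity) (by positivity),
          div_le_div_iff₀ (by positivity) (by positivity)]
        nlinarith
      rw [H2_succ]
      push_cast
      linarith
  have : (0 : ℝ) ≤ 1 / ((k : ℝ) + 1 / 2) := by positivity
  linarith

/-- First component of the WZ pair (without the sign `(-1)^n`), with `a = n + 1/2`. -/
noncomputable def wzF (a : ℝ) (k : ℕ) : ℝ :=
  sqFactorialRatio a k * (1 / (a + k) ^ 3 - H2 k / (a + k))

/-- Second component of the WZ pair (without the sign `(-1)^n`), with `a = n + 1/2`. -/
noncomputable def wzG (a : ℝ) (k : ℕ) : ℝ :=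
  sqFactorialRatio a k / (a + 2 * k + 1) *
    (1 / (a + k) ^ 2 + (k + 1) / (a + k) ^ 3 - H2 k / 2 - H2 k * (k + 1) / (a + k))

lemma wzF_sub_wzF_succ {a : ℝ} (ha : 0 < a) (k : ℕ) :
    wzF a k - wzF a (k + 1) = wzG a k + wzG (a + 1) k := by
  unfold wzF wzG
  rw [sqFactorialRatio_succ, sqFactorialRatio_shift ha, H2_succ]
  have h1 : a + 2 * (k : ℝ) + 1 ≠ 0 := by positivity
  have h2 : a + 2 * (k : ℝ) + 2 ≠ 0 := by positivity
  have h3 : a + (k : ℝ) ≠ 0 := by positivity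
  have h4 : a + (k : ℝ) + 1 ≠ 0 := by positivity
  have h5 : (k : ℝ) + 1 ≠ 0 := by positivity
  have e1 : a + 1 + 2 * (k : ℝ) + 1 = a + 2 * k + 2 := by ring
  have e2 : a + 1 + (k : ℝ) = a + k + 1 := by ring
  have e3 : a + ((k + 1 : ℕ) : ℝ) = a + k + 1 := by push_cast; ring
  rw [e1, e2, e3]
  generalize sqFactorialRatio a k = b
  generalize H2 k = h
  field_simp
  ring

lemma abs_wzF_le {a : ℝ} (ha : 1 / 2 ≤ a) (k : ℕ) : |wzF a k| ≤ 24 * (1 / 2) ^ k := by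
  have hk : (0 : ℝ) ≤ k := k.cast_nonneg
  have ha0 : 0 < a := by linarith
  have hH0 := H2_nonneg k
  have hH := H2_le_two k
  have hu : 1 / (a + k) ≤ 2 := by
    rw [div_le_iff₀ (by positivity)]; linarith
  have hu0 : 0 ≤ 1 / (a + k) := by positivity
  have hb := sqFactorialRatio_le ha k
  have hb0 := sqFactorialRatio_nonneg ha0 k
  have hinv : a⁻¹ ≤ 2 := by
    rw [inv_le_comm₀ ha0 (by norm_num)]; linarith
  have hB : sqFactorialRatio a k ≤ 2 * (1 / 2) ^ k :=
    hb.trans (mul_le_mul_of_nonneg_right hinv (by positivity))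
  have e : 1 / (a + k) ^ 3 - H2 k / (a + k) = (1 / (a + k)) ^ 3 - H2 k * (1 / (a + k)) := by
    field_simp
  have hc : |1 / (a + k) ^ 3 - H2 k / (a + k)| ≤ 12 := by
    have h3 : (1 / (a + k)) ^ 3 ≤ 2 ^ 3 := by gcongr
    have h30 : 0 ≤ (1 / (a + k)) ^ 3 := by positivity
    have h4 : H2 k * (1 / (a + k)) ≤ 2 * 2 := by gcongr
    have h40 : 0 ≤ H2 k * (1 / (a + k)) := by positivity
    rw [e, abs_le]
    constructor <;> linarith
  unfold wzF
  rw [abs_mul, abs_of_nonneg hb0]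
  calc _ ≤ (2 * (1 / 2) ^ k) * (12 : ℝ) := by gcongr
    _ = _ := by ring

lemma abs_wzG_le {a : ℝ} (ha : 1 / 2 ≤ a) (k : ℕ) :
    |wzG a k| ≤ 17 * (1 / a ^ 2) * (1 / 2) ^ k := by
  have hk : (0 : ℝ) ≤ k := k.cast_nonneg
  have ha0 : 0 < a := by linarith
  have hH0 := H2_nonneg k
  have hH := H2_le_two k
  have hu : 1 / (a + k) ≤ 2 := by
    rw [div_le_iff₀ (by positivity)]; linarith
  have hu0 : 0 ≤ 1 / (a + k) := by positivity
  have hv : (k + 1) / (a + k) ≤ 2 := by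
    rw [div_le_iff₀ (by positivity)]; linarith
  have hv0 : 0 ≤ (k + 1) / (a + k) := by positivity
  have hb := sqFactorialRatio_le ha k
  have hb0 := sqFactorialRatio_nonneg ha0 k
  have hB : sqFactorialRatio a k / (a + 2 * k + 1) ≤ 1 / a ^ 2 * (1 / 2) ^ k := by
    calc _ ≤ a⁻¹ * (1 / 2) ^ k / a := by gcongr; linarith
      _ = _ := by field_simp
  have e : 1 / (a + k) ^ 2 + (k + 1) / (a + k) ^ 3 - H2 k / 2 - H2 k * (k + 1) / (a + k) =
      (1 / (a + k)) ^ 2 + (k + 1) / (a + k) * (1 / (a + k)) ^ 2 - H2 k / 2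
        - H2 k * ((k + 1) / (a + k)) := by
    field_simp
  have hc : |1 / (a + k) ^ 2 + (k + 1) / (a + k) ^ 3 - H2 k / 2 - H2 k * (k + 1) / (a + k)|
      ≤ 17 := by
    have h2 : (1 / (a + k)) ^ 2 ≤ 2 ^ 2 := by gcongr
    have h20 : 0 ≤ (1 / (a + k)) ^ 2 := by positivity
    have h3 : (k + 1) / (a + k) * (1 / (a + k)) ^ 2 ≤ 2 * 2 ^ 2 := by gcongr
    have h30 : 0 ≤ (k + 1) / (a + k) * (1 / (a + k)) ^ 2 := by positivity
    have h4 : H2 k * ((k + 1) / (a + k)) ≤ 2 * 2 := by gcongr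
    have h40 : 0 ≤ H2 k * ((k + 1) / (a + k)) := by positivity
    rw [e, abs_le]
    constructor <;> linarith
  unfold wzG
  rw [abs_mul, abs_of_nonneg (by positivity)]
  calc _ ≤ (1 / a ^ 2 * (1 / 2) ^ k) * (17 : ℝ) := by gcongr
    _ = _ := by ring

lemma sum_wzF_sub_sum_wzF (m l : ℕ) :
    ∑ n ∈ Finset.range m, (-1 : ℝ) ^ n * wzF (n + 1 / 2) 0 -
      ∑ n ∈ Finset.range m, (-1 : ℝ) ^ n * wzF (n + 1 / 2) l =
    ∑ k ∈ Finset.range l, wzG (1 / 2) k -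
      (-1) ^ m * ∑ k ∈ Finset.range l, wzG (m + 1 / 2) k := by
  induction m with
  | zero => simp
  | succ m ih =>
    have ht : wzF (m + 1 / 2) 0 - wzF (m + 1 / 2) l =
        ∑ k ∈ Finset.range l, wzG (m + 1 / 2) k +
          ∑ k ∈ Finset.range l, wzG (m + 1 / 2 + 1) k := by
      rw [← Finset.sum_range_sub', ← Finset.sum_add_distrib]
      exact Finset.sum_congr rfl fun k _ => wzF_sub_wzF_succ (by positivity) k
    have e : ((m + 1 : ℕ) : ℝ) + 1 / 2 = m + 1 / 2 + 1 := by push_cast; ring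
    rw [Finset.sum_range_succ, Finset.sum_range_succ, e, pow_succ]
    linear_combination ih + (-1) ^ m * ht

lemma tendsto_sum_wzF :
    Tendsto (fun m : ℕ => ∑ n ∈ Finset.range m, (-1 : ℝ) ^ n * wzF (n + 1 / 2) m)
      atTop (𝓝 0) := by
  have h : Tendsto (fun m : ℕ => 24 * ((m : ℝ) * (1 / 2) ^ m)) atTop (𝓝 0) := by
    simpa using (tendsto_self_mul_const_pow_of_lt_one (r := (1 / 2 : ℝ))
      (by norm_num) (by norm_num)).const_mul 24
  refine squeeze_zero_norm (fun m => ?_) h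
  calc _ ≤ ∑ n ∈ Finset.range m, (24 * (1 / 2) ^ m : ℝ) := by
        refine norm_sum_le_of_le _ fun n _ => ?_
        rw [norm_mul, norm_pow, norm_neg, norm_one, one_pow, one_mul]
        exact abs_wzF_le (by have : (0 : ℝ) ≤ n := n.cast_nonneg
                             linarith) m
    _ = _ := by rw [Finset.sum_const, Finset.card_range, nsmul_eq_mul]; ring

lemma tendsto_sum_wzG :
    Tendsto (fun m : ℕ => (-1 : ℝ) ^ m * ∑ k ∈ Finset.range m, wzG (m + 1 / 2) k)
      atTop (𝓝 0) := by
  have h : Tendsto (fun m : ℕ => 17 * (1 / ((m : ℝ) + 1 / 2))) atTop (𝓝 0) := by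
    have := (tendsto_const_nhds (x := (17 : ℝ))).div_atTop
      (tendsto_atTop_add_const_right atTop (1 / 2 : ℝ) (tendsto_natCast_atTop_atTop (R := ℝ)))
    simpa [div_eq_mul_inv] using this
  refine squeeze_zero_norm (fun m => ?_) h
  have hm : (0 : ℝ) ≤ m := m.cast_nonneg
  rw [norm_mul, norm_pow, norm_neg, norm_one, one_pow, one_mul]
  calc _ ≤ ∑ k ∈ Finset.range m, (17 * (1 / ((m : ℝ) + 1 / 2) ^ 2)) := by
        refine norm_sum_le_of_le _ fun k _ => ?_
        refine (abs_wzG_le (by linarith) k).trans ?_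
        exact mul_le_of_le_one_right (by positivity) (pow_le_one₀ (by norm_num) (by norm_num))
    _ = 17 * (m / ((m : ℝ) + 1 / 2) ^ 2) := by
        rw [Finset.sum_const, Finset.card_range, nsmul_eq_mul]; ring
    _ ≤ _ := by
        gcongr 17 * ?_
        rw [div_le_div_iff₀ (by positivity) (by positivity)]
        nlinarith

lemma summable_wzG_half : Summable (wzG (1 / 2)) :=
  .of_norm_bounded (summable_geometric_two.mul_left _) fun k => abs_wzG_le le_rfl k

lemma wzF_zero (a : ℝ) : wzF a 0 = 1 / a ^ 4 := by
  simp only [wzF, sqFactorialRatio_zero, H2, Finset.range_zero, Finset.sum_empty]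
  push_cast
  by_cases ha : a = 0
  · simp [ha]
  · field_simp
    simp [ha]

lemma hasSum_wzF_zero :
    HasSum (fun n : ℕ => (-1 : ℝ) ^ n * wzF (n + 1 / 2) 0) (16 * beta4) := by
  have hs : Summable fun k : ℕ => (-1 : ℝ) ^ k / (1 + 2 * (k : ℝ)) ^ 4 := by
    have h1 : Summable fun k : ℕ => 1 / ((k + 1 : ℕ) : ℝ) ^ 4 :=
      (summable_nat_add_iff 1).2 (Real.summable_one_div_nat_pow.2 (by norm_num))
    refine .of_norm_bounded h1 fun k => ?_
    have hk : (0 : ℝ) ≤ k := k.cast_nonneg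
    rw [norm_div, norm_pow, norm_neg, norm_one, one_pow, Real.norm_of_nonneg (by positivity)]
    push_cast
    exact one_div_le_one_div_of_le (by positivity)
      (pow_le_pow_left₀ (by positivity) (by linarith) 4)
  have e : (fun n : ℕ => (-1 : ℝ) ^ n * wzF (n + 1 / 2) 0) =
      fun n : ℕ => 16 * ((-1 : ℝ) ^ n / (1 + 2 * (n : ℝ)) ^ 4) := by
    funext n
    have h2 : 1 + 2 * (n : ℝ) ≠ 0 := by positivity
    rw [wzF_zero, show (n : ℝ) + 1 / 2 = (1 + 2 * n) / 2 by ring]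
    field_simp
    norm_num
  rw [e]
  exact hs.hasSum.mul_left 16

lemma tsum_wzG_half : ∑' k, wzG (1 / 2) k = 16 * beta4 := by
  have hF := hasSum_wzF_zero.tendsto_sum_nat
  have hG := summable_wzG_half.hasSum.tendsto_sum_nat
  refine tendsto_nhds_unique hG ?_
  have := (hF.sub tendsto_sum_wzF).add tendsto_sum_wzG
  simp only [sub_zero, add_zero] at this
  refine this.congr fun m => ?_
  rw [sum_wzF_sub_sum_wzF]
  ring

lemma poch_ratio_eq (k : ℕ) :
    (1 / 4 : ℝ) ^ k * (poch 1 k ^ 2 / (poch (5 / 4) k * poch (7 / 4) k)) =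
      3 / 4 * (sqFactorialRatio (1 / 2) k / (1 / 2 + 2 * k + 1)) := by
  induction k with
  | zero => norm_num [poch, sqFactorialRatio_zero]
  | succ k ih =>
    have hs (x : ℝ) : poch x (k + 1) = poch x k * (x + k) := Finset.prod_range_succ _ _
    have h0 {x : ℝ} (hx : 0 < x) : poch x k ≠ 0 :=
      Finset.prod_ne_zero_iff.2 fun i _ => by positivity
    have h1 := h0 (x := 5 / 4) (by norm_num)
    have h2 := h0 (x := 7 / 4) (by norm_num)
    have h3 : (5 / 4 : ℝ) + k ≠ 0 := by positivity
    have h4 : (7 / 4 : ℝ) + k ≠ 0 := by positivity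
    calc _ = (1 / 4 : ℝ) ^ k * (poch 1 k ^ 2 / (poch (5 / 4) k * poch (7 / 4) k)) *
          (1 / 4 * ((1 + k) ^ 2 / ((5 / 4 + k) * (7 / 4 + k)))) := by
          rw [hs, hs, hs, pow_succ]
          field_simp
      _ = _ := by
          rw [ih, sqFactorialRatio_succ]
          push_cast
          have h5 : (1 / 2 : ℝ) + 2 * k + 1 ≠ 0 := by positivity
          have h6 : (1 / 2 : ℝ) + 2 * k + 2 ≠ 0 := by positivity
          have h7 : (1 / 2 : ℝ) + 2 * (k + 1) + 1 ≠ 0 := by positivity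
          generalize sqFactorialRatio (1 / 2) k = b
          have e3 : (5 / 4 : ℝ) + k = (1 / 2 + 2 * k + 2) / 2 := by ring
          have e4 : (7 / 4 : ℝ) + k = (1 / 2 + 2 * (k + 1) + 1) / 2 := by ring
          rw [e3, e4]
          field_simp
          ring

theorem stmt2 :
    (∑' k : ℕ, (1/4 : ℝ) ^ k * (poch 1 k ^ 2 / (poch (5/4) k * poch (7/4) k)) *
      ((5 + 6 * (k : ℝ)) / (1 + 2 * (k : ℝ)) * H2 k -
        (24 + 32 * (k : ℝ)) / (1 + 2 * (k : ℝ)) ^ 3)) = -24 * beta4 := by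
  have h : ∀ k : ℕ, (1/4 : ℝ) ^ k * (poch 1 k ^ 2 / (poch (5/4) k * poch (7/4) k)) *
      ((5 + 6 * (k : ℝ)) / (1 + 2 * (k : ℝ)) * H2 k -
        (24 + 32 * (k : ℝ)) / (1 + 2 * (k : ℝ)) ^ 3) = -(3 / 2) * wzG (1 / 2) k := by
    intro k
    rw [poch_ratio_eq, wzG]
    generalize sqFactorialRatio (1 / 2) k / (1 / 2 + 2 * (k : ℝ) + 1) = b
    have h2 : 1 + 2 * (k : ℝ) ≠ 0 := by positivity
    have e : 1 / 2 + (k : ℝ) = (1 + 2 * k) / 2 := by ring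
    rw [e]
    field_simp
    ring
  simp_rw [h]
  rw [tsum_mul_left, tsum_wzG_half]
  ring
end

section
/- The infinite series identity $\sum_{k=0}^{\infty}\frac{((1)_{2k})^3}{((3/2)_{2k})^3\,8^{2k}}\cdot\frac{49+342k+840k^2+880k^3+336k^4}{(3+4k)^3} = 2G$ holds. -/
open scoped BigOperators

open Filter Topology Finset
open scoped Nat

lemma poch_zero (x : ℝ) : poch x 0 = 1 := by simp [poch]

lemma poch_succ (x : ℝ) (n : ℕ) : poch x (n + 1) = poch x n * (x + n) := by
  simp [poch, Finset.prod_range_succ]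

lemma poch_pos {x : ℝ} (hx : 0 < x) (n : ℕ) : 0 < poch x n :=
  Finset.prod_pos fun i _ => by positivity

/-- Shifting the base point of a shifted factorial. -/
lemma poch_add_one_mul (x : ℝ) (n : ℕ) : poch (x + 1) n * x = poch x n * (x + n) := by
  induction n with
  | zero => simp [poch_zero]
  | succ n ih =>
    rw [poch_succ, poch_succ]
    push_cast
    linear_combination (x + 1 + n) * ih

lemma poch_three_half (n : ℕ) : poch (3 / 2) n = poch (1 / 2) n * (2 * n + 1) := by
  have h := poch_add_one_mul (1 / 2) n
  norm_num at h ⊢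
  linear_combination 2 * h

/-- The normalized central binomial coefficient `(1/2)_k / k!`. -/
noncomputable def centralRatio (k : ℕ) : ℝ := poch (1 / 2) k / k !

lemma centralRatio_pos (k : ℕ) : 0 < centralRatio k :=
  div_pos (poch_pos (by norm_num) k) (by positivity)

lemma centralRatio_succ (k : ℕ) :
    centralRatio (k + 1) = centralRatio k * ((2 * k + 1) / (2 * k + 2)) := by
  rw [centralRatio, centralRatio, poch_succ, Nat.factorial_succ]
  push_cast
  field_simp
  ring

lemma centralRatio_sq_le (k : ℕ) : centralRatio k ^ 2 ≤ 1 / (2 * k + 1) := by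
  induction k with
  | zero => simp [centralRatio, poch_zero]
  | succ k ih =>
    rw [centralRatio_succ, mul_pow]
    refine (mul_le_mul_of_nonneg_right ih (by positivity)).trans ?_
    rw [div_pow, div_mul_div_comm, div_le_div_iff₀ (by positivity) (by positivity)]
    push_cast
    have : (0 : ℝ) ≤ k := by positivity
    nlinarith [mul_nonneg this this, mul_nonneg (mul_nonneg this this) this]

lemma le_centralRatio_sq (k : ℕ) : 1 / (4 * k + 1) ≤ centralRatio k ^ 2 := by
  induction k with
  | zero => simp [centralRatio, poch_zero]
  | succ k ih =>
    rw [centralRatio_succ, mul_pow]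
    refine le_trans ?_ (mul_le_mul_of_nonneg_right ih (by positivity))
    rw [div_pow, div_mul_div_comm, div_le_div_iff₀ (by positivity) (by positivity)]
    push_cast
    have : (0 : ℝ) ≤ k := by positivity
    nlinarith [mul_nonneg this this, mul_nonneg (mul_nonneg this this) this]

lemma tendsto_one_div_two_mul_add_one :
    Tendsto (fun k : ℕ => 1 / (2 * (k : ℝ) + 1)) atTop (𝓝 0) := by
  refine squeeze_zero (fun k => by positivity) (fun k => ?_)
    (tendsto_one_div_add_atTop_nhds_zero_nat (𝕜 := ℝ))
  apply one_div_le_one_div_of_le (by positivity)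
  have : (0 : ℝ) ≤ k := by positivity
  linarith

lemma tendsto_zero_of_sq {u : ℕ → ℝ} (h : Tendsto (fun k => u k ^ 2) atTop (𝓝 0)) :
    Tendsto u atTop (𝓝 0) := by
  have h2 := h.sqrt
  simp only [Real.sqrt_sq_eq_abs, Real.sqrt_zero] at h2
  exact (tendsto_zero_iff_abs_tendsto_zero u).2 h2

lemma tendsto_centralRatio : Tendsto centralRatio atTop (𝓝 0) :=
  tendsto_zero_of_sq (squeeze_zero (fun _ => sq_nonneg _) centralRatio_sq_le
    tendsto_one_div_two_mul_add_one)

/-- A nonnegative sequence with telescoping partial sums is summable. -/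
lemma hasSum_of_telescope {f g : ℕ → ℝ} (hf : ∀ k, 0 ≤ f k) (h : ∀ k, f k = g k - g (k + 1))
    (hg : Tendsto g atTop (𝓝 0)) : HasSum f (g 0) := by
  rw [hasSum_iff_tendsto_nat_of_nonneg hf]
  simp_rw [h, Finset.sum_range_sub']
  simpa using hg.const_sub (g 0)

/-- The summand of the Gauss series `₂F₁(j + 1/2, j + 1; 2j + 2; 1)`, suitably normalized. -/
noncomputable def gaussTerm (j i : ℕ) : ℝ :=
  poch (1 / 2) (j + i) * (j + i)! / (i ! * (2 * j + i + 1)!)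

lemma gaussTerm_pos (j i : ℕ) : 0 < gaussTerm j i :=
  div_pos (mul_pos (poch_pos (by norm_num) _) (by positivity)) (by positivity)

lemma gaussTerm_succ_left (j i : ℕ) : gaussTerm (j + 1) i =
    gaussTerm j i * ((j + i + 1 / 2) * (j + i + 1) / ((2 * j + i + 2) * (2 * j + i + 3))) := by
  rw [gaussTerm, gaussTerm, show j + 1 + i = (j + i) + 1 by ring,
    show 2 * (j + 1) + i + 1 = (2 * j + i + 1) + 1 + 1 by ring, poch_succ,
    Nat.factorial_succ (j + i), Nat.factorial_succ (2 * j + i + 1 + 1),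
    Nat.factorial_succ (2 * j + i + 1)]
  push_cast
  field_simp
  ring

lemma gaussTerm_succ_right (j i : ℕ) : gaussTerm j (i + 1) =
    gaussTerm j i * ((j + i + 1 / 2) * (j + i + 1) / ((i + 1) * (2 * j + i + 2))) := by
  rw [gaussTerm, gaussTerm, show j + (i + 1) = (j + i) + 1 by ring,
    show 2 * j + (i + 1) + 1 = (2 * j + i + 1) + 1 by ring, poch_succ,
    Nat.factorial_succ (j + i), Nat.factorial_succ (2 * j + i + 1), Nat.factorial_succ i]
  push_cast
  field_simp
  ring

lemma gaussTerm_zero_left (i : ℕ) : gaussTerm 0 i = centralRatio i / (i + 1) := by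
  rw [gaussTerm, centralRatio, show 2 * 0 + i + 1 = i + 1 by ring, Nat.factorial_succ, zero_add]
  push_cast
  field_simp

lemma gaussTerm_le (j i : ℕ) : gaussTerm j i ≤ centralRatio i / (i + 1) := by
  induction j with
  | zero => exact (gaussTerm_zero_left i).le
  | succ j ih =>
    rw [gaussTerm_succ_left]
    refine le_trans (mul_le_of_le_one_right (gaussTerm_pos j i).le ?_) ih
    rw [div_le_one (by positivity)]
    apply mul_le_mul <;> first | positivity | skip
    all_goals
      have : (0 : ℝ) ≤ j := by positivity
      linarith

/-- The Zeilberger certificate of the Gauss series, as a function of `i`. -/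
noncomputable def gaussCert (j i : ℕ) : ℝ :=
  i * (4 * i + 6 * j + 5) / (2 * j + i + 2) * gaussTerm j i

lemma gaussCert_telescope (j i : ℕ) :
    (2 * j + 1) * gaussTerm j i - (2 * j + 3) * gaussTerm (j + 1) i =
      gaussCert j (i + 1) - gaussCert j i := by
  rw [gaussCert, gaussCert, gaussTerm_succ_left, gaussTerm_succ_right]
  push_cast
  field_simp
  ring

lemma tendsto_gaussCert (j : ℕ) : Tendsto (gaussCert j) atTop (𝓝 0) := by
  have h := tendsto_centralRatio.const_mul (4 + 6 * j + 5 : ℝ)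
  rw [mul_zero] at h
  refine squeeze_zero (fun i => ?_) (fun i => ?_) h
  · have := gaussTerm_pos j i
    rw [gaussCert]
    positivity
  · have hi : (0 : ℝ) ≤ i := by positivity
    have hj : (0 : ℝ) ≤ j := by positivity
    calc gaussCert j i ≤ ((4 + 6 * j + 5) * (i + 1)) * (centralRatio i / (i + 1)) := by
          refine mul_le_mul ?_ (gaussTerm_le j i) (gaussTerm_pos j i).le (by positivity)
          rw [div_le_iff₀ (by positivity)]
          nlinarith [mul_nonneg hi hj, mul_nonneg hi hi, mul_nonneg (mul_nonneg hi hi) hj,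
            mul_nonneg (mul_nonneg hi hj) hj, mul_nonneg hj hj]
      _ = _ := by field_simp

lemma hasSum_gaussTerm_zero : HasSum (gaussTerm 0) 2 := by
  have h := hasSum_of_telescope (f := gaussTerm 0) (g := fun i => 2 * centralRatio i)
    (fun i => (gaussTerm_pos 0 i).le) (fun i => ?_) (by simpa using tendsto_centralRatio.const_mul 2)
  · simpa [centralRatio, poch_zero] using h
  · rw [centralRatio_succ, gaussTerm_zero_left]
    field_simp
    ring

lemma summable_gaussTerm (j : ℕ) : Summable (gaussTerm j) := by
  refine Summable.of_nonneg_of_le (fun i => (gaussTerm_pos j i).le) (fun i => ?_)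
    hasSum_gaussTerm_zero.summable
  exact (gaussTerm_le j i).trans (gaussTerm_zero_left i).ge

lemma hasSum_gaussTerm (j : ℕ) : HasSum (gaussTerm j) (2 / (2 * j + 1)) := by
  induction j with
  | zero => simpa using hasSum_gaussTerm_zero
  | succ j ih =>
    have h1 := ((ih.mul_left (2 * j + 1 : ℝ)).sub
      ((summable_gaussTerm (j + 1)).hasSum.mul_left (2 * j + 3 : ℝ))).tendsto_sum_nat
    simp_rw [gaussCert_telescope, Finset.sum_range_sub] at h1
    have h2 := (tendsto_gaussCert j).sub_const (gaussCert j 0)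
    have h3 := tendsto_nhds_unique h1 h2
    have h4 : gaussCert j 0 = 0 := by simp [gaussCert]
    have h5 : ∑' i, gaussTerm (j + 1) i = 2 / (2 * (j + 1 : ℕ) + 1) := by
      rw [h4, mul_div_cancel₀ _ (by positivity)] at h3
      rw [eq_div_iff (by positivity)]
      push_cast
      linarith
    exact h5 ▸ (summable_gaussTerm (j + 1)).hasSum

/-- The summand of the finite alternating sum that evaluates to `1 / (3/2)_k²`. -/
noncomputable def bailey (k j : ℕ) : ℝ :=
  (-1) ^ j / ((2 * j + 1) * ((k - j)! * (k + j + 1)!))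

lemma sum_bailey_diff {k J : ℕ} (hJ : J ≤ k) :
    ∑ j ∈ range J, (((k : ℝ) + 3 / 2) ^ 2 * bailey (k + 1) j - bailey k j) =
      -((-1 : ℝ) ^ J * J / (4 * (k + 1) * ((k + 1 - J)! * (k + 1 + J)!))) := by
  induction J with
  | zero => simp
  | succ J ih =>
    obtain ⟨i, rfl⟩ := Nat.exists_eq_add_of_le hJ
    rw [Finset.sum_range_succ, ih (by omega), bailey, bailey,
      show J + 1 + i + 1 - J = i + 1 + 1 by omega, show J + 1 + i - J = i + 1 by omega,
      show J + 1 + i + 1 - (J + 1) = i + 1 by omega,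
      show J + 1 + i + 1 + J + 1 = (2 * J + i + 2) + 1 by ring,
      show J + 1 + i + J + 1 = 2 * J + i + 2 by ring,
      show J + 1 + i + 1 + J = 2 * J + i + 2 by ring,
      show J + 1 + i + 1 + (J + 1) = (2 * J + i + 2) + 1 by ring,
      Nat.factorial_succ (i + 1), Nat.factorial_succ (2 * J + i + 2)]
    push_cast
    field_simp
    ring

lemma sum_bailey (k : ℕ) : ∑ j ∈ range (k + 1), bailey k j = 1 / poch (3 / 2) k ^ 2 := by
  induction k with
  | zero => simp [bailey, poch_zero]
  | succ k ih =>
    have h := sum_bailey_diff (le_refl k)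
    rw [show k + 1 - k = 1 by omega, show k + 1 + k = 2 * k + 1 by ring, Nat.factorial_one,
      Nat.cast_one, one_mul, Finset.sum_sub_distrib, ← Finset.mul_sum] at h
    rw [Finset.sum_range_succ] at ih
    have hp := poch_pos (x := 3 / 2) (by norm_num) k
    have hk : ((k : ℝ) + 3 / 2) ^ 2 * ∑ j ∈ range (k + 1 + 1), bailey (k + 1) j =
        1 / poch (3 / 2) k ^ 2 := by
      rw [Finset.sum_range_succ, Finset.sum_range_succ, ← ih]
      have e : ((k : ℝ) + 3 / 2) ^ 2 * (bailey (k + 1) k + bailey (k + 1) (k + 1)) - bailey k k =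
          (-1) ^ k * k / (4 * (k + 1) * (2 * k + 1)!) := by
        rw [bailey, bailey, bailey, show k + 1 - k = 1 by omega, Nat.sub_self, Nat.sub_self,
          show k + 1 + k + 1 = (2 * k + 1) + 1 by ring, show k + k + 1 = 2 * k + 1 by ring,
          show k + 1 + (k + 1) + 1 = (2 * k + 1) + 1 + 1 by ring,
          Nat.factorial_succ (2 * k + 1 + 1), Nat.factorial_succ (2 * k + 1)]
        push_cast
        field_simp
        simp
        ring
      linear_combination h + e
    rw [poch_succ, eq_div_iff (by positivity)]
    rw [eq_div_iff (by positivity)] at hk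
    linear_combination hk

/-- The summand of the series `₃F₂((n+1)/2, (n+2)/2, 1; n+3/2, n+3/2; 1)`. -/
noncomputable def slowTerm (n k : ℕ) : ℝ :=
  poch (n + 1) (2 * k) / (4 ^ k * poch (n + 3 / 2) k ^ 2)

lemma slowTerm_pos (n k : ℕ) : 0 < slowTerm n k := by
  have := poch_pos (x := n + 1) (by positivity) (2 * k)
  have := poch_pos (x := n + 3 / 2) (by positivity) k
  rw [slowTerm]
  positivity

lemma slowTerm_succ_right (n k : ℕ) : slowTerm n (k + 1) =
    slowTerm n k * ((n + 1 + 2 * k) * (n + 2 + 2 * k) / (4 * (n + 3 / 2 + k) ^ 2)) := by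
  have := (poch_pos (x := n + 3 / 2) (by positivity) k).ne'
  rw [slowTerm, slowTerm, show 2 * (k + 1) = 2 * k + 1 + 1 by ring, poch_succ, poch_succ,
    poch_succ]
  push_cast
  field_simp
  ring

lemma slowTerm_succ_left (n k : ℕ) : slowTerm (n + 1) k =
    slowTerm n k * ((n + 1 + 2 * k) * (n + 3 / 2) ^ 2 / ((n + 1) * (n + 3 / 2 + k) ^ 2)) := by
  induction k with
  | zero => simp [slowTerm, poch_zero]; field_simp
  | succ k ih =>
    rw [slowTerm_succ_right, ih, slowTerm_succ_right]
    push_cast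
    field_simp
    ring

lemma slowTerm_zero_left (k : ℕ) :
    slowTerm 0 k = poch (1 / 2) k * k ! * (1 / poch (3 / 2) k ^ 2) := by
  induction k with
  | zero => simp [slowTerm, poch_zero]
  | succ k ih =>
    have := (poch_pos (x := 3 / 2) (by norm_num) k).ne'
    rw [slowTerm_succ_right, ih, poch_succ, poch_succ, Nat.factorial_succ]
    push_cast
    field_simp
    ring

lemma slowTerm_zero_left_eq (k : ℕ) :
    (2 * k + 1) * slowTerm 0 k = 1 / ((2 * k + 1) * centralRatio k) := by
  have := (poch_pos (x := 1 / 2) (by norm_num) k).ne'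
  rw [slowTerm_zero_left, poch_three_half, centralRatio]
  field_simp

lemma tendsto_mul_slowTerm_zero :
    Tendsto (fun k : ℕ => (2 * (k : ℝ) + 1) * slowTerm 0 k) atTop (𝓝 0) := by
  refine tendsto_zero_of_sq (squeeze_zero (fun _ => sq_nonneg _) (fun k => ?_)
    (by simpa using tendsto_one_div_two_mul_add_one.const_mul 2))
  have h := le_centralRatio_sq k
  have hw := centralRatio_pos k
  rw [slowTerm_zero_left_eq, div_pow, mul_pow, one_pow, ← div_eq_mul_inv,
    div_le_div_iff₀ (by positivity) (by positivity)]
  rw [div_le_iff₀ (by positivity)] at h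
  nlinarith [sq_nonneg (centralRatio k), mul_nonneg (sq_nonneg (centralRatio k))
    (by positivity : (0 : ℝ) ≤ k)]

lemma slowTerm_le (n k : ℕ) : slowTerm n k ≤ 2 ^ n * slowTerm 0 k := by
  induction n with
  | zero => simp
  | succ n ih =>
    have h : slowTerm (n + 1) k ≤ slowTerm n k * 2 := by
      rw [slowTerm_succ_left]
      refine mul_le_mul_of_nonneg_left ?_ (slowTerm_pos n k).le
      rw [div_le_iff₀ (by positivity)]
      have hn : (0 : ℝ) ≤ n := by positivity
      have hk : (0 : ℝ) ≤ k := by positivity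
      nlinarith [mul_nonneg hn hk, mul_nonneg hn hn, mul_nonneg (mul_nonneg hn hn) hn,
        mul_nonneg hk hk, mul_nonneg (mul_nonneg hn hn) hk, mul_nonneg (mul_nonneg hn hk) hk]
    rw [pow_succ]
    linarith

/-- The array whose row sums give the Catalan series and whose antidiagonal sums give
the series of `slowTerm 0`. -/
noncomputable def catalanArray (p : ℕ × ℕ) : ℝ := (-1) ^ p.1 / (2 * p.1 + 1) * gaussTerm p.1 p.2

lemma sum_antidiagonal_catalanArray (k : ℕ) :
    ∑ p ∈ antidiagonal k, catalanArray p = slowTerm 0 k := by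
  rw [slowTerm_zero_left, ← sum_bailey, Finset.mul_sum,
    Finset.Nat.sum_antidiagonal_eq_sum_range_succ_mk]
  refine Finset.sum_congr rfl fun j hj => ?_
  have hj : j ≤ k := by simpa [Nat.lt_succ_iff] using hj
  obtain ⟨i, rfl⟩ := Nat.exists_eq_add_of_le hj
  simp only [catalanArray, gaussTerm, bailey, Nat.add_sub_cancel_left]
  rw [show j + i + j + 1 = 2 * j + i + 1 by ring]
  field_simp

lemma summable_one_div_odd_sq : Summable fun j : ℕ => 2 / (2 * (j : ℝ) + 1) ^ 2 := by
  have h := ((summable_nat_add_iff 1).2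
    (Real.summable_one_div_nat_pow.2 (by norm_num : 1 < 2))).mul_left 2
  refine Summable.of_nonneg_of_le (fun j => by positivity) (fun j => ?_) h
  rw [mul_one_div]
  push_cast
  gcongr
  have : (0 : ℝ) ≤ j := by positivity
  linarith

lemma hasSum_norm_row (j : ℕ) :
    HasSum (fun i => ‖catalanArray (j, i)‖) (2 / (2 * (j : ℝ) + 1) ^ 2) := by
  have h := (hasSum_gaussTerm j).mul_left (1 / (2 * (j : ℝ) + 1))
  have e : (fun i => ‖catalanArray (j, i)‖) = fun i => 1 / (2 * (j : ℝ) + 1) * gaussTerm j i := by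
    funext i
    rw [catalanArray, norm_mul, norm_div, norm_pow, norm_neg, norm_one, one_pow,
      Real.norm_of_nonneg (gaussTerm_pos j i).le, Real.norm_of_nonneg (by positivity)]
  rwa [e, show 2 / (2 * (j : ℝ) + 1) ^ 2 = 1 / (2 * j + 1) * (2 / (2 * j + 1)) by field_simp]

lemma summable_catalanArray : Summable catalanArray := by
  refine Summable.of_norm ((summable_prod_of_nonneg fun _ => norm_nonneg _).2
    ⟨fun j => (hasSum_norm_row j).summable, ?_⟩)
  simpa only [(hasSum_norm_row _).tsum_eq] using summable_one_div_odd_sq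

lemma hasSum_slowTerm_zero : HasSum (slowTerm 0) (2 * catalanG) := by
  have hrow : ∀ j : ℕ, HasSum (fun i => catalanArray (j, i))
      (2 * ((-1) ^ j / (1 + 2 * (j : ℝ)) ^ 2)) := fun j => by
    have h := (hasSum_gaussTerm j).mul_left ((-1) ^ j / (2 * (j : ℝ) + 1))
    rwa [show (-1) ^ j / (2 * (j : ℝ) + 1) * (2 / (2 * j + 1)) =
      2 * ((-1) ^ j / (1 + 2 * (j : ℝ)) ^ 2) by rw [add_comm (1 : ℝ)]; field_simp] at h
  have hS := summable_catalanArray.hasSum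
  have hsum := (hS.prod_fiberwise hrow).tsum_eq
  rw [tsum_mul_left] at hsum
  have hd := (Finset.HasAntidiagonal.sigmaAntidiagonalEquivProd (A := ℕ)).hasSum_iff.2 hS
  have hk := hd.sigma (fun k => hasSum_fintype _)
  rw [catalanG, hsum]
  refine hk.congr_fun fun k => ?_
  rw [← sum_antidiagonal_catalanArray]
  exact (Finset.sum_coe_sort (antidiagonal k) catalanArray).symm

lemma summable_slowTerm (n : ℕ) : Summable (slowTerm n) :=
  Summable.of_nonneg_of_le (fun k => (slowTerm_pos n k).le) (slowTerm_le n)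
    (hasSum_slowTerm_zero.summable.mul_left _)

lemma tsum_slowTerm_le (n : ℕ) : ∑' k, slowTerm n k ≤ 2 ^ n * (2 * catalanG) := by
  rw [← hasSum_slowTerm_zero.tsum_eq, ← tsum_mul_left]
  exact (summable_slowTerm n).tsum_le_tsum (slowTerm_le n)
    (hasSum_slowTerm_zero.summable.mul_left _)

lemma slowTerm_telescope (n k : ℕ) :
    (4 * n + 2) * slowTerm n k +
        (n + 1) ^ 3 / (2 * (n + 3 / 2) ^ 2) * slowTerm (n + 1) k =
      (4 * k + 6 * n + 4) * slowTerm n k -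
        (4 * (k + 1 : ℕ) + 6 * n + 4) * slowTerm n (k + 1) := by
  rw [slowTerm_succ_left, slowTerm_succ_right]
  push_cast
  field_simp
  ring

lemma tendsto_slowCert (n : ℕ) :
    Tendsto (fun k : ℕ => (4 * (k : ℝ) + 6 * n + 4) * slowTerm n k) atTop (𝓝 0) := by
  have h := tendsto_mul_slowTerm_zero.const_mul ((6 * n + 4) * 2 ^ n : ℝ)
  rw [mul_zero] at h
  refine squeeze_zero (fun k => ?_) (fun k => ?_) h
  · have := slowTerm_pos n k
    positivity
  · have hn : (0 : ℝ) ≤ n := by positivity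
    have hk : (0 : ℝ) ≤ k := by positivity
    calc (4 * (k : ℝ) + 6 * n + 4) * slowTerm n k
        ≤ ((6 * n + 4) * (2 * k + 1)) * (2 ^ n * slowTerm 0 k) := by
          refine mul_le_mul ?_ (slowTerm_le n k) (slowTerm_pos n k).le (by positivity)
          nlinarith [mul_nonneg hn hk]
      _ = _ := by ring

lemma tsum_slowTerm_recurrence (n : ℕ) :
    (4 * n + 2) * ∑' k, slowTerm n k +
      (n + 1) ^ 3 / (2 * (n + 3 / 2) ^ 2) * ∑' k, slowTerm (n + 1) k = 6 * n + 4 := by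
  have h := ((summable_slowTerm n).hasSum.mul_left (4 * n + 2 : ℝ)).add
    ((summable_slowTerm (n + 1)).hasSum.mul_left ((n + 1) ^ 3 / (2 * (n + 3 / 2) ^ 2) : ℝ))
  have h2 := hasSum_of_telescope (fun k => ?_) (slowTerm_telescope n) (tendsto_slowCert n)
  · rw [h.unique h2]
    simp [slowTerm, poch_zero]
  · have := slowTerm_pos n k
    have := slowTerm_pos (n + 1) k
    positivity

/-- The coefficient of the series in powers of `-1/8`. -/
noncomputable def fastCoeff (n : ℕ) : ℝ := (-1 / 8) ^ n * (poch 1 n ^ 3 / poch (3 / 2) n ^ 3)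

lemma fastCoeff_succ (n : ℕ) :
    fastCoeff (n + 1) = fastCoeff n * (-(n + 1) ^ 3 / (8 * (n + 3 / 2) ^ 3)) := by
  have := (poch_pos (x := 3 / 2) (by norm_num) n).ne'
  rw [fastCoeff, fastCoeff, poch_succ, poch_succ]
  field_simp
  ring

lemma abs_fastCoeff_le (n : ℕ) : |fastCoeff n| ≤ (1 / 8) ^ n := by
  induction n with
  | zero => simp [fastCoeff, poch_zero]
  | succ n ih =>
    rw [fastCoeff_succ, abs_mul, pow_succ (1 / 8 : ℝ)]
    refine mul_le_mul ih ?_ (abs_nonneg _) (by positivity)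
    rw [neg_div, abs_neg, abs_of_nonneg (by positivity),
      div_le_div_iff₀ (by positivity) (by positivity), one_mul, mul_comm]
    gcongr
    norm_num

lemma sum_fastCoeff (N : ℕ) :
    ∑ n ∈ range N, fastCoeff n * (3 * n + 2) =
      2 * catalanG - (2 * N + 1) * fastCoeff N * ∑' k, slowTerm N k := by
  induction N with
  | zero => simp [fastCoeff, poch_zero, hasSum_slowTerm_zero.tsum_eq]
  | succ N ih =>
    have hr := tsum_slowTerm_recurrence N
    have e : (2 * ((N + 1 : ℕ) : ℝ) + 1) * fastCoeff (N + 1) =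
        -(fastCoeff N * ((N + 1) ^ 3 / (2 * (N + 3 / 2) ^ 2)) / 2) := by
      rw [fastCoeff_succ]
      push_cast
      field_simp
      ring
    rw [Finset.sum_range_succ, ih, e]
    linear_combination -(fastCoeff N / 2) * hr

lemma tendsto_sum_fastCoeff :
    Tendsto (fun N => ∑ n ∈ range N, fastCoeff n * (3 * n + 2)) atTop (𝓝 (2 * catalanG)) := by
  simp_rw [sum_fastCoeff]
  suffices h : Tendsto (fun N : ℕ => (2 * (N : ℝ) + 1) * fastCoeff N * ∑' k, slowTerm N k)
      atTop (𝓝 0) by simpa using h.const_sub (2 * catalanG)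
  have hb : Tendsto (fun N : ℕ => 2 * (2 * catalanG) * ((N : ℝ) * (1 / 4) ^ N) +
      2 * catalanG * (1 / 4 : ℝ) ^ N) atTop (𝓝 0) := by
    have h1 := (tendsto_self_mul_const_pow_of_lt_one (r := (1 / 4 : ℝ)) (by norm_num)
      (by norm_num)).const_mul (2 * (2 * catalanG))
    have h2 := (tendsto_pow_atTop_nhds_zero_of_lt_one (r := (1 / 4 : ℝ)) (by norm_num)
      (by norm_num)).const_mul (2 * catalanG)
    simpa using h1.add h2
  refine squeeze_zero_norm (fun N => ?_) hb
  have hW : 0 ≤ ∑' k, slowTerm N k := tsum_nonneg fun k => (slowTerm_pos N k).le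
  rw [norm_mul, norm_mul, Real.norm_of_nonneg hW, Real.norm_of_nonneg (by positivity),
    Real.norm_eq_abs]
  calc (2 * (N : ℝ) + 1) * |fastCoeff N| * ∑' k, slowTerm N k
      ≤ (2 * (N : ℝ) + 1) * (1 / 8) ^ N * (2 ^ N * (2 * catalanG)) := by
        gcongr
        · exact abs_fastCoeff_le N
        · exact tsum_slowTerm_le N
    _ = _ := by
        rw [show (1 / 4 : ℝ) = 1 / 8 * 2 by norm_num, mul_pow]
        ring

lemma fastCoeff_pair (k : ℕ) :
    poch 1 (2 * k) ^ 3 / (poch (3/2) (2 * k) ^ 3 * (8 : ℝ) ^ (2 * k)) *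
      ((49 + 342 * (k : ℝ) + 840 * (k : ℝ) ^ 2 + 880 * (k : ℝ) ^ 3 + 336 * (k : ℝ) ^ 4) /
        (3 + 4 * (k : ℝ)) ^ 3) =
    fastCoeff (2 * k) * (3 * (2 * k : ℕ) + 2) +
      fastCoeff (2 * k + 1) * (3 * (2 * k + 1 : ℕ) + 2) := by
  have := (poch_pos (x := 3 / 2) (by norm_num) (2 * k)).ne'
  have h8 : (-1 / 8 : ℝ) ^ (2 * k) = 1 / 8 ^ (2 * k) := by
    rw [div_pow, pow_mul]
    norm_num
  rw [fastCoeff_succ, fastCoeff, h8]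
  push_cast
  field_simp
  ring

theorem stmt7 :
    (∑' k : ℕ, poch 1 (2 * k) ^ 3 / (poch (3/2) (2 * k) ^ 3 * (8 : ℝ) ^ (2 * k)) *
      ((49 + 342 * (k : ℝ) + 840 * (k : ℝ) ^ 2 + 880 * (k : ℝ) ^ 3 + 336 * (k : ℝ) ^ 4) /
        (3 + 4 * (k : ℝ)) ^ 3)) = 2 * catalanG := by
  refine HasSum.tsum_eq ((hasSum_iff_tendsto_nat_of_nonneg (fun k => ?_) _).2 ?_)
  · have := poch_pos one_pos (2 * k)
    have := poch_pos (x := 3 / 2) (by norm_num) (2 * k)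
    positivity
  · have hpair : ∀ K : ℕ, ∑ k ∈ range K, (fastCoeff (2 * k) * (3 * (2 * k : ℕ) + 2) +
        fastCoeff (2 * k + 1) * (3 * (2 * k + 1 : ℕ) + 2)) =
        ∑ n ∈ range (2 * K), fastCoeff n * (3 * n + 2) := fun K => by
      induction K with
      | zero => simp
      | succ K ih =>
        rw [Finset.sum_range_succ, ih, show 2 * (K + 1) = 2 * K + 1 + 1 by ring,
          Finset.sum_range_succ, Finset.sum_range_succ, add_assoc]
    simp_rw [fastCoeff_pair, hpair]
    exact tendsto_sum_fastCoeff.comp (tendsto_id.const_mul_atTop' two_pos)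
end
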